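/- For every integer k ≥ 2, let b_n denote the number of all regular expressions over Σ of size n. Then R_n/b_n is asymptotically equivalent, as n → ∞, to (√(ψ_k(η_k))/√(2−2ρ_k))·(ρ_k/η_k)^{n+1}; in particular, since ρ_k < η_k, the ratio R_n/b_n tends to 0 as n → ∞. -/

import Mathlib

open Filter Set

/-- Regular expressions over an alphabet `A` (grammar β := ε | σ | β+β | β·β | β⋆). -/
inductive RegEx (A : Type) : Type where
  | eps : RegEx A
  | char (a : A) : RegEx A
  | plus (l r : RegEx A) : RegEx A
  | cat (l r : RegEx A) : RegEx A
  | star (e : RegEx A) : RegEx A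

namespace RegEx

/-- The (tree-)size of an expression: number of symbols / syntax-tree nodes. -/
def size {A : Type} : RegEx A → ℕ
  | eps => 1
  | char _ => 1
  | plus l r => size l + size r + 1
  | cat l r => size l + size r + 1
  | star e => size e + 1

/-- The number of letter occurrences (alphabetic size). -/
def letters {A : Type} : RegEx A → ℕ
  | eps => 0
  | char _ => 1
  | plus l r => letters l + letters r
  | cat l r => letters l + letters r
  | star e => letters e

/-- `IsUnionOfLetters e l` : `e` is a binary union tree whose leaves are single letters,
read from left to right giving the list `l`. -/
inductive IsUnionOfLetters {A : Type} : RegEx A → List A → Prop where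
  | char (a : A) : IsUnionOfLetters (char a) [a]
  | plus {l r : RegEx A} {ll rl : List A} :
      IsUnionOfLetters l ll → IsUnionOfLetters r rl →
      IsUnionOfLetters (plus l r) (ll ++ rl)

/-- `e` is of the form `(σ_{i₁}+⋯+σ_{i_k})⋆` where `σ_{i₁},…,σ_{i_k}` is a permutation of
the (finite) alphabet `A`. -/
def IsSigmaStar {A : Type} [Fintype A] (e : RegEx A) : Prop :=
  ∃ (f : RegEx A) (l : List A),
    e = star f ∧ IsUnionOfLetters f l ∧ l.Nodup ∧ ∀ a : A, a ∈ l

/-- The absorbing pattern `Σ⋆` does not occur in `e` as an argument of a union. -/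
def Avoids {A : Type} [Fintype A] : RegEx A → Prop
  | eps => True
  | char _ => True
  | plus l r => Avoids l ∧ Avoids r ∧ ¬ IsSigmaStar l ∧ ¬ IsSigmaStar r
  | cat l r => Avoids l ∧ Avoids r
  | star e => Avoids e

end RegEx

/-- Number of expressions in `REna` (over a `k`-letter alphabet) of size `n`. -/
noncomputable def Rcount (k n : ℕ) : ℕ :=
  Nat.card {e : RegEx (Fin k) // RegEx.Avoids e ∧ RegEx.size e = n}

/-- Number of all regular expressions (over a `k`-letter alphabet) of size `n`. -/
noncomputable def Bcount (k n : ℕ) : ℕ :=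
  Nat.card {e : RegEx (Fin k) // RegEx.size e = n}

/-- Total number of letter occurrences over all expressions in `REna` of size `n`. -/
noncomputable def Lcount (k n : ℕ) : ℕ :=
  Nat.card {p : RegEx (Fin k) × ℕ //
    RegEx.Avoids p.1 ∧ RegEx.size p.1 = n ∧ p.2 < RegEx.letters p.1}

/-- `C_k = (2k-2)!/(k-1)!` as a real number. -/
noncomputable def Cc (k : ℕ) : ℝ :=
  ((2 * k - 2).factorial : ℝ) / ((k - 1).factorial : ℝ)

/-- `p_k(z) = 1 − 2z − (7+8k)z²`. -/
noncomputable def Pp (k : ℕ) (z : ℝ) : ℝ := 1 - 2 * z - (7 + 8 * k) * z ^ 2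

/-- `h_k(z) = 1 − z − C_k·z^{2k+1}`. -/
noncomputable def Hh (k : ℕ) (z : ℝ) : ℝ := 1 - z - Cc k * z ^ (2 * k + 1)

/-- `Δ_k(z) = p_k(z) + 4·C_k·z^{2k+1}·h_k(z)`. -/
noncomputable def Dd (k : ℕ) (z : ℝ) : ℝ :=
  Pp k z + 4 * Cc k * z ^ (2 * k + 1) * Hh k z

/-- `g_k(z) = 2 − C_k·z^{2k−1}·(h_k(z) − C_k·z^{2k−1})`. -/
noncomputable def Gg (k : ℕ) (z : ℝ) : ℝ :=
  2 - Cc k * z ^ (2 * k - 1) * (Hh k z - Cc k * z ^ (2 * k - 1))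

/-- `ρ_k = 1/(1+√(8+8k))`, the positive root of `p_k`. -/
noncomputable def rho (k : ℕ) : ℝ := 1 / (1 + Real.sqrt (8 + 8 * k))

/-- `ψ_k(x) = −x·Δ_k′(x)`. -/
noncomputable def psi (k : ℕ) (x : ℝ) : ℝ := -x * deriv (Dd k) x

/-- `η` is a root of `Δ_k` in the interval `(0, 1/√(8+8k))`, and is the unique such root. -/
def IsEta (k : ℕ) (η : ℝ) : Prop :=
  η ∈ Set.Ioo (0 : ℝ) (1 / Real.sqrt (8 + 8 * k)) ∧ Dd k η = 0 ∧
    ∀ x ∈ Set.Ioo (0 : ℝ) (1 / Real.sqrt (8 + 8 * k)), Dd k x = 0 → x = η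

/-- Signed coefficients of `√(1 - x)`. -/
noncomputable def sqrtCoeff (n : ℕ) : ℝ := (-1) ^ n * Ring.choose (1 / 2 : ℝ) n

lemma sqrtCoeff_zero : sqrtCoeff 0 = 1 := by simp [sqrtCoeff]

lemma sqrtCoeff_succ (n : ℕ) :
    sqrtCoeff (n + 1) = sqrtCoeff n * ((2 * n - 1) / (2 * n + 2)) := by
  have h : (n + 1 : ℝ) ≠ 0 := by positivity
  have h2 : (n.factorial : ℝ) ≠ 0 := by positivity
  simp only [sqrtCoeff, Ring.choose_eq_smul, descPochhammer_succ_right,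
    Polynomial.smeval_mul, Polynomial.smeval_sub, Polynomial.smeval_X, Polynomial.smeval_natCast,
    Nat.factorial_succ, smul_eq_mul, pow_zero, pow_one, nsmul_eq_mul, mul_one, Nat.cast_mul]
  push_cast
  field_simp
  ring

lemma sqrtCoeff_neg (n : ℕ) : sqrtCoeff (n + 1) < 0 := by
  induction n with
  | zero => rw [sqrtCoeff_succ, sqrtCoeff_zero]; norm_num
  | succ n ih =>
    rw [sqrtCoeff_succ]
    refine mul_neg_of_neg_of_pos ih ?_
    push_cast
    have : (0:ℝ) ≤ n := by positivity
    apply div_pos <;> linarith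

lemma sqrtCoeff_ne_zero (n : ℕ) : sqrtCoeff n ≠ 0 := by
  cases n with
  | zero => simp [sqrtCoeff_zero]
  | succ n => exact (sqrtCoeff_neg n).ne

lemma tendsto_sqrtCoeff_ratio :
    Tendsto (fun n => sqrtCoeff n / sqrtCoeff (n + 1)) atTop (nhds 1) := by
  have h1 : Tendsto (fun n : ℕ => 1 + (3 / 2) * (1 / ((n : ℝ) + 1))) atTop (nhds (1 + 3 / 2 * 0)) :=
    tendsto_const_nhds.add (tendsto_one_div_add_atTop_nhds_zero_nat.const_mul _)
  have h2 : Tendsto (fun n : ℕ => (2 * (n : ℝ) + 2) / (2 * n - 1)) atTop (nhds 1) := by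
    rw [← tendsto_add_atTop_iff_nat 1]
    have h3 := (tendsto_one_div_add_atTop_nhds_zero_nat (𝕜 := ℝ)).const_mul 3
    have h4 : Tendsto (fun n : ℕ => (2 + 2 * (1 / ((n : ℝ) + 1))) / (2 - 1 / ((n : ℝ) + 1)))
        atTop (nhds ((2 + 2 * 0) / (2 - 0))) :=
      (tendsto_const_nhds.add (tendsto_one_div_add_atTop_nhds_zero_nat.const_mul _)).div
        (tendsto_const_nhds.sub tendsto_one_div_add_atTop_nhds_zero_nat) (by norm_num)
    norm_num at h4
    refine h4.congr fun n => ?_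
    have : (n + 1 : ℝ) ≠ 0 := by positivity
    have h6 : (0 : ℝ) ≤ n := by positivity
    have h5 : (2 * (n + 1) - 1 : ℝ) ≠ 0 := by linarith
    push_cast
    field_simp
  refine h2.congr fun n => ?_
  rw [sqrtCoeff_succ, ← div_div, div_self (sqrtCoeff_ne_zero n), one_div_div]

lemma tendsto_sqrtCoeff_shift (j : ℕ) :
    Tendsto (fun n => sqrtCoeff (n - j) / sqrtCoeff n) atTop (nhds 1) := by
  rw [← tendsto_add_atTop_iff_nat j]
  simp only [Nat.add_sub_cancel]
  induction j with
  | zero => simp [div_self (sqrtCoeff_ne_zero _)]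
  | succ j ih =>
    have := ih.mul (tendsto_sqrtCoeff_ratio.comp (tendsto_add_atTop_nat j))
    rw [one_mul] at this
    refine this.congr fun n => ?_
    simp only [Function.comp]
    rw [div_mul_div_cancel₀ (sqrtCoeff_ne_zero _)]
    rfl

lemma monotone_weighted_sqrtCoeff :
    Monotone fun n : ℕ => |sqrtCoeff (n + 1)| * ((n : ℝ) + 2) ^ 4 := by
  refine monotone_nat_of_le_succ fun n => ?_
  rw [sqrtCoeff_succ (n + 1), abs_mul, mul_assoc]
  refine mul_le_mul_of_nonneg_left ?_ (abs_nonneg _)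
  have h6 : (0 : ℝ) ≤ n := by positivity
  push_cast
  rw [abs_of_nonneg (by apply div_nonneg <;> linarith), div_mul_eq_mul_div, le_div_iff₀ (by linarith)]
  have : (2 * ((n:ℝ) + 1) - 1) * (n + 1 + 2) ^ 4 - (n + 2) ^ 4 * (2 * (n + 1) + 2)
    = 5 * n ^ 4 + 40 * n ^ 3 + 110 * n ^ 2 + 110 * n + 17 := by ring
  have : (0:ℝ) ≤ 5 * n ^ 4 + 40 * n ^ 3 + 110 * n ^ 2 + 110 * n + 17 := by positivity
  linarith

lemma abs_sqrtCoeff_le (m j : ℕ) :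
    |sqrtCoeff m| ≤ 2 * ((j : ℝ) + 1) ^ 4 * |sqrtCoeff (m + j)| := by
  cases m with
  | zero =>
    rw [sqrtCoeff_zero, abs_one, zero_add]
    cases j with
    | zero => simp [sqrtCoeff_zero]
    | succ i =>
      have h := monotone_weighted_sqrtCoeff (Nat.zero_le i)
      simp only [sqrtCoeff_succ 0, sqrtCoeff_zero] at h
      norm_num at h
      push_cast
      rw [show (i : ℝ) + 1 + 1 = i + 2 by ring]
      linarith
  | succ m =>
    have h := monotone_weighted_sqrtCoeff (Nat.le_add_right m j)
    simp only [Nat.cast_add] at h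
    rw [show m + 1 + j = m + j + 1 by ring]
    have hm : (0 : ℝ) ≤ m := by positivity
    have hj : (0 : ℝ) ≤ j := by positivity
    have h1 : ((m : ℝ) + j + 2) ^ 4 ≤ ((m + 2) * (j + 1)) ^ 4 := by
      gcongr
      nlinarith
    rw [mul_pow] at h1
    have h2 : |sqrtCoeff (m + 1)| * ((m : ℝ) + 2) ^ 4
        ≤ (((j : ℝ) + 1) ^ 4 * |sqrtCoeff (m + j + 1)|) * ((m : ℝ) + 2) ^ 4 := by
      refine h.trans ((mul_le_mul_of_nonneg_left h1 (abs_nonneg _)).trans_eq (by ring))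
    have h3 := le_of_mul_le_mul_right h2 (by positivity)
    have h4 : 0 ≤ ((j : ℝ) + 1) ^ 4 * |sqrtCoeff (m + j + 1)| := by positivity
    linarith

open Polynomial in
lemma exists_powerSeries_sqrt (Q : ℝ[X]) (r : ℝ) (hr : 0 < r)
    (hQ : ∀ z : ℂ, ‖z‖ < r → 0 < (aeval z Q).re) (h0 : Q.coeff 0 = 1) :
    ∃ q : PowerSeries ℂ, q * q = ((Q.map (algebraMap ℝ ℂ) : ℂ[X]) : PowerSeries ℂ) ∧
      PowerSeries.constantCoeff q = 1 ∧ ∀ x : ℝ, |x| < r →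
        HasSum (fun n => PowerSeries.coeff n q * (x : ℂ) ^ n) ((√(Q.eval x) : ℝ) : ℂ) := by
  set P := Q.map (algebraMap ℝ ℂ) with hP
  have hPe : ∀ z : ℂ, P.eval z = aeval z Q := fun z => by
    rw [hP, eval_map_algebraMap]
  set f : ℂ → ℂ := fun z => (P.eval z) ^ (1 / 2 : ℂ) with hf
  have hslit : ∀ z : ℂ, ‖z‖ < r → P.eval z ∈ Complex.slitPlane := fun z hz =>
    Or.inl (by rw [hPe]; exact hQ z hz)
  have hd : DifferentiableOn ℂ f (Metric.ball 0 r) := fun z hz =>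
    (P.differentiable.differentiableAt.cpow_const
      (hslit z (by simpa using hz))).differentiableWithinAt
  have hsq : ∀ z : ℂ, ‖z‖ < r → f z * f z = P.eval z := fun z hz => by
    have h1 := Complex.slitPlane_ne_zero (hslit z hz)
    rw [hf, ← Complex.cpow_add _ _ h1]
    norm_num
  have hf0 : f 0 = 1 := by
    simp only [hf]
    rw [← coeff_zero_eq_eval_zero, hP, coeff_map, h0]
    simp
  have hev : (f * f) =ᶠ[nhds 0] fun z => P.eval z := by
    filter_upwards [Metric.ball_mem_nhds (0 : ℂ) hr] with z hz
    exact hsq z (by simpa using hz)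
  have hcd : ∀ n : ℕ, ContDiffAt ℂ n f 0 := fun n =>
    (hd.analyticAt (Metric.ball_mem_nhds (0 : ℂ) hr)).contDiffAt
  have hit : ∀ n, iteratedDeriv n (fun z => P.eval z) 0 = n.factorial * P.coeff n := fun n => by
    have h1 : iteratedDeriv n (fun z => P.eval z) = fun z => (derivative^[n] P).eval z := by
      induction n with
      | zero => simp
      | succ n ih =>
        rw [iteratedDeriv_succ, ih, Function.iterate_succ_apply']
        ext z
        simp
    rw [h1]
    simp only
    rw [← coeff_zero_eq_eval_zero, coeff_iterate_derivative]
    simp [Nat.descFactorial_self]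
  refine ⟨PowerSeries.mk fun n => (n.factorial : ℂ)⁻¹ * iteratedDeriv n f 0, ?_, ?_, ?_⟩
  · ext n
    rw [PowerSeries.coeff_mul, Polynomial.coeff_coe]
    simp only [PowerSeries.coeff_mk]
    have h1 := hev.iteratedDeriv_eq n
    rw [hit, iteratedDeriv_mul (hcd n) (hcd n)] at h1
    have h2 : (n.factorial : ℂ) ≠ 0 := by exact_mod_cast n.factorial_ne_zero
    rw [← mul_right_inj' h2, ← h1, Finset.Nat.sum_antidiagonal_eq_sum_range_succ_mk,
      Finset.mul_sum]
    refine Finset.sum_congr rfl fun i hi => ?_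
    have hi' : i ≤ n := by simpa [Nat.lt_succ_iff] using hi
    rw [Nat.cast_choose ℂ hi']
    have h3 : (i.factorial : ℂ) ≠ 0 := by exact_mod_cast i.factorial_ne_zero
    have h4 : ((n - i).factorial : ℂ) ≠ 0 := by exact_mod_cast (n - i).factorial_ne_zero
    field_simp
  · rw [← PowerSeries.coeff_zero_eq_constantCoeff_apply]
    simp [hf0]
  · intro x hx
    have hx' : ‖(x : ℂ)‖ < r := by simpa using hx
    have h1 := Complex.hasSum_taylorSeries_on_ball hd (z := (x : ℂ)) (by simpa using hx')
    have h2 : f x = ((√(Q.eval x) : ℝ) : ℂ) := by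
      have h3 : P.eval (x : ℂ) = ((Q.eval x : ℝ) : ℂ) := by
        rw [hPe]
        exact (aeval_algebraMap_apply_eq_algebraMap_eval x Q)
      have h4 : 0 ≤ Q.eval x := by
        have h5 := hQ x hx'
        rw [← hPe, h3, Complex.ofReal_re] at h5
        exact h5.le
      simp only [hf]
      rw [h3, Real.sqrt_eq_rpow, Complex.ofReal_cpow h4]
      norm_num
    rw [← h2]
    have h6 : (fun n => PowerSeries.coeff n (PowerSeries.mk fun n =>
        (n.factorial : ℂ)⁻¹ * iteratedDeriv n f 0) * (x : ℂ) ^ n) =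
        fun n : ℕ => (n.factorial : ℂ)⁻¹ • ((x : ℂ) - 0) ^ n • iteratedDeriv n f 0 := by
      funext n
      simp only [PowerSeries.coeff_mk, sub_zero, smul_eq_mul]
      ring
    rw [h6]
    exact h1

lemma summable_norm_mul_pow_mul {q : ℕ → ℂ} {x y : ℝ} (hx : 0 < x) (hxy : x < y)
    (h : Summable fun n => q n * (y : ℂ) ^ n) :
    Summable fun n => ‖q n‖ * x ^ n * (2 * ((n : ℝ) + 1) ^ 4) := by
  have hy : 0 < y := hx.trans hxy
  have h1 := h.tendsto_atTop_zero.norm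
  obtain ⟨M, hM⟩ := h1.bddAbove_range
  have h2 : Summable fun n : ℕ => ((n : ℝ)) ^ 4 * (x / y) ^ n :=
    summable_pow_mul_geometric_of_norm_lt_one 4 (by
      rw [Real.norm_of_nonneg (by positivity)]
      exact (div_lt_one hy).2 hxy)
  have h3 := ((summable_nat_add_iff 1).2 h2).mul_left (2 * M * (y / x))
  refine Summable.of_nonneg_of_le (fun n => by positivity) (fun n => ?_) h3
  have h4 : ‖q n‖ * y ^ n ≤ M := by
    have := hM ⟨n, rfl⟩
    simpa [abs_of_pos hy] using this
  have h5 : ‖q n‖ * x ^ n ≤ M * (x / y) ^ n := by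
    rw [div_pow, mul_div_assoc', le_div_iff₀ (by positivity)]
    calc ‖q n‖ * x ^ n * y ^ n = (‖q n‖ * y ^ n) * x ^ n := by ring
      _ ≤ M * x ^ n := by gcongr
  calc ‖q n‖ * x ^ n * (2 * ((n : ℝ) + 1) ^ 4)
      ≤ M * (x / y) ^ n * (2 * ((n : ℝ) + 1) ^ 4) := by gcongr
    _ = _ := by
      rw [pow_succ (x / y)]
      push_cast
      field_simp

/-- Convolving `sqrtCoeff` with a rapidly decaying sequence only rescales its asymptotics. -/
lemma tendsto_conv_sqrtCoeff (b : ℕ → ℂ) (s : ℂ) (hb : HasSum b s)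
    (hs : Summable fun n => ‖b n‖ * (2 * ((n : ℝ) + 1) ^ 4)) :
    Tendsto (fun n => (∑ j ∈ Finset.range (n + 1), b j * (sqrtCoeff (n - j) : ℂ)) / sqrtCoeff n)
      atTop (nhds s) := by
  have key := tendsto_tsum_of_dominated_convergence (𝓕 := atTop)
    (f := fun n j => if j ≤ n then b j * ((sqrtCoeff (n - j) / sqrtCoeff n : ℝ) : ℂ) else 0)
    (g := b) hs (fun j => ?_) (Eventually.of_forall fun n j => ?_)
  · rw [hb.tsum_eq] at key
    refine key.congr fun n => ?_
    rw [tsum_eq_sum (s := Finset.range (n + 1)), Finset.sum_div]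
    · refine Finset.sum_congr rfl fun j hj => ?_
      rw [if_pos (by simpa [Nat.lt_succ_iff] using hj)]
      push_cast
      ring
    · intro j hj
      rw [if_neg (by simpa [Nat.lt_succ_iff] using hj)]
  · have h1 := ((Complex.continuous_ofReal.tendsto 1).comp (tendsto_sqrtCoeff_shift j)).const_mul
      (b j)
    simp only [Complex.ofReal_one, mul_one] at h1
    refine h1.congr' ?_
    filter_upwards [eventually_ge_atTop j] with n hn
    simp [hn]
  · split_ifs with h
    · rw [norm_mul, Complex.norm_real, Real.norm_eq_abs, abs_div]
      refine mul_le_mul_of_nonneg_left ?_ (norm_nonneg _)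
      rw [div_le_iff₀ (abs_pos.2 (sqrtCoeff_ne_zero n))]
      have := abs_sqrtCoeff_le (n - j) j
      rwa [Nat.sub_add_cancel h] at this
    · rw [norm_zero]
      positivity


lemma exists_powerSeries_sqrt_one_sub (c : ℝ) :
    ∃ w : PowerSeries ℝ, w * w = 1 - PowerSeries.C c * PowerSeries.X ∧
      ∀ n, PowerSeries.coeff n w = sqrtCoeff n * c ^ n := by
  refine ⟨PowerSeries.rescale (-c) (PowerSeries.binomialSeries ℝ (1 / 2 : ℝ)), ?_, fun n => ?_⟩
  · rw [← map_mul, ← PowerSeries.binomialSeries_add, add_halves]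
    have := PowerSeries.binomialSeries_nat (R := ℝ) (A := ℝ) 1
    rw [Nat.cast_one, pow_one] at this
    rw [this]
    simp [PowerSeries.rescale_X, sub_eq_add_neg]
  · rw [PowerSeries.coeff_rescale, PowerSeries.binomialSeries_coeff, sqrtCoeff, smul_eq_mul,
      mul_one, neg_pow]
    ring

open Polynomial in
/-- Singularity analysis for a quadratic algebraic generating function whose discriminant has
a single simple zero `η` in a disc of radius greater than `η`. -/
theorem tendsto_coeff_of_sq_eq (A : PowerSeries ℝ) (L Q : ℝ[X]) (η r : ℝ) (hη : 0 < η)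
    (hr : η < r) (hQ : ∀ z : ℂ, ‖z‖ < r → 0 < (aeval z Q).re) (h0 : Q.coeff 0 = 1)
    (hL : L.coeff 0 = 1)
    (h : ((L : PowerSeries ℝ) - 4 * PowerSeries.X * A) ^ 2 =
      (1 - PowerSeries.C η⁻¹ * PowerSeries.X) * (Q : PowerSeries ℝ)) :
    Tendsto (fun n => 4 * PowerSeries.coeff n A * η ^ (n + 1) / sqrtCoeff (n + 1)) atTop
      (nhds (-√(Q.eval η))) := by
  obtain ⟨q, hq, hq0, hqs⟩ := exists_powerSeries_sqrt Q r (hη.trans hr) hQ h0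
  obtain ⟨w, hw, hwc⟩ := exists_powerSeries_sqrt_one_sub η⁻¹
  set φ := PowerSeries.map (algebraMap ℝ ℂ) with hφ
  set T : PowerSeries ℝ := (L : PowerSeries ℝ) - 4 * PowerSeries.X * A with hT
  have hsq : (φ T) ^ 2 = (φ w * q) ^ 2 := by
    rw [← map_pow, h, mul_pow, sq q, hq, sq, ← map_mul, hw, map_mul, Polynomial.polynomial_map_coe]
  have hT0 : PowerSeries.constantCoeff (φ T) = 1 := by
    rw [← PowerSeries.coeff_zero_eq_constantCoeff_apply, hφ, PowerSeries.coeff_map, hT, map_sub,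
      Polynomial.coeff_coe, hL, mul_comm (4 : PowerSeries ℝ), mul_assoc,
      PowerSeries.coeff_zero_X_mul]
    simp
  have hw0 : PowerSeries.constantCoeff (φ w * q) = 1 := by
    rw [map_mul, hq0, ← PowerSeries.coeff_zero_eq_constantCoeff_apply, hφ, PowerSeries.coeff_map,
      hwc, sqrtCoeff_zero]
    simp
  have heq : φ T = φ w * q := by
    rcases sq_eq_sq_iff_eq_or_eq_neg.1 hsq with h1 | h1
    · exact h1
    · have h2 := congrArg PowerSeries.constantCoeff h1
      rw [map_neg, hT0, hw0] at h2
      norm_num at h2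
  obtain ⟨x, hx1, hx2⟩ := exists_between hr
  have hsum := (hqs x (by rwa [abs_of_pos (hη.trans hx1)])).summable
  have hs := summable_norm_mul_pow_mul hη hx1 hsum
  have hlim := tendsto_conv_sqrtCoeff (fun n => PowerSeries.coeff n q * (η : ℂ) ^ n) _
    (hqs η (by rwa [abs_of_pos hη])) (by
      simpa [abs_of_pos hη] using hs)
  have hlim1 := (hlim.comp (tendsto_add_atTop_nat 1)).neg
  have hre := (Complex.continuous_re.tendsto _).comp hlim1
  rw [Complex.neg_re, Complex.ofReal_re] at hre
  refine hre.congr' ?_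
  filter_upwards [eventually_ge_atTop L.natDegree] with n hn
  have hc := congrArg (PowerSeries.coeff (n + 1)) heq
  rw [hφ, PowerSeries.coeff_map, hT, map_sub, Polynomial.coeff_coe,
    Polynomial.coeff_eq_zero_of_natDegree_lt (by omega), mul_comm (4 : PowerSeries ℝ), mul_assoc,
    PowerSeries.coeff_succ_X_mul, mul_comm (PowerSeries.map _ w), PowerSeries.coeff_mul (n + 1) q,
    Finset.Nat.sum_antidiagonal_eq_sum_range_succ_mk] at hc
  have h4 : PowerSeries.coeff n (4 * A) = 4 * PowerSeries.coeff n A := by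
    rw [show (4 : PowerSeries ℝ) = PowerSeries.C 4 from (map_ofNat PowerSeries.C 4).symm,
      PowerSeries.coeff_C_mul]
  have hsum : ∑ j ∈ Finset.range (n + 1 + 1), PowerSeries.coeff j q * (η : ℂ) ^ j *
      (sqrtCoeff (n + 1 - j) : ℂ) = ((-(4 * PowerSeries.coeff n A * η ^ (n + 1)) : ℝ) : ℂ) := by
    have h5 : ((-(4 * PowerSeries.coeff n A * η ^ (n + 1)) : ℝ) : ℂ) =
      algebraMap ℝ ℂ (0 - PowerSeries.coeff n (4 * A)) * (η : ℂ) ^ (n + 1) := by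
      rw [h4]
      simp
    rw [h5, hc, Finset.sum_mul]
    refine Finset.sum_congr rfl fun j hj => ?_
    have hj' : j ≤ n + 1 := by simpa [Nat.lt_succ_iff] using hj
    rw [PowerSeries.coeff_map, hwc]
    obtain ⟨m, hm⟩ : ∃ m, n + 1 = j + m := ⟨n + 1 - j, by omega⟩
    rw [hm]
    have : (η : ℂ) ≠ 0 := by exact_mod_cast hη.ne'
    simp only [Nat.add_sub_cancel_left, map_mul, Complex.coe_algebraMap, map_pow, map_inv₀,
      inv_pow, pow_add]
    field_simp
  simp only [Function.comp]
  rw [hsum, ← Complex.ofReal_div, ← Complex.ofReal_neg, Complex.ofReal_re]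
  ring

section Discriminant

open Polynomial

/-- The discriminant of `A = z (k + 1 + (A - c z^{2k})² + A² + A)`, as a polynomial in `z`. -/
noncomputable def disc (k : ℕ) (c : ℝ) : ℝ[X] :=
  1 - 2 * X - (7 + 8 * (k : ℝ[X])) * X ^ 2
    + 4 * C c * X ^ (2 * k + 1) * (1 - X - C c * X ^ (2 * k + 1))

/-- The quotient of `disc k c` by `X - η`, for a root `η`. -/
noncomputable def discQuot (k : ℕ) (c η : ℝ) : ℝ[X] :=
  -2 - (7 + 8 * (k : ℝ[X])) * (X + C η)
    + 4 * C c * (∑ i ∈ Finset.range (2 * k + 1), X ^ i * C η ^ (2 * k + 1 - 1 - i)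
      - ∑ i ∈ Finset.range (2 * k + 2), X ^ i * C η ^ (2 * k + 2 - 1 - i)
      - C c * ∑ i ∈ Finset.range (4 * k + 2), X ^ i * C η ^ (4 * k + 2 - 1 - i))

lemma discQuot_mul (k : ℕ) (c η : ℝ) (h : (disc k c).eval η = 0) :
    discQuot k c η * (X - C η) = disc k c := by
  have h1 : disc k c = disc k c - C ((disc k c).eval η) := by simp [h]
  have h2 : C ((disc k c).eval η) = 1 - 2 * C η - (7 + 8 * (k : ℝ[X])) * C η ^ 2
    + 4 * C c * C η ^ (2 * k + 1) * (1 - C η - C c * C η ^ (2 * k + 1)) := by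
    simp only [disc, eval_add, eval_sub, eval_mul, eval_pow, eval_X, eval_C, eval_one,
      eval_ofNat, eval_natCast, map_add, map_sub, map_mul, map_pow, map_one, map_ofNat, map_natCast]
  rw [h1, h2, discQuot, disc]
  have e1 := geom_sum₂_mul (X : ℝ[X]) (C η) (2 * k + 1)
  have e2 := geom_sum₂_mul (X : ℝ[X]) (C η) (2 * k + 2)
  have e3 := geom_sum₂_mul (X : ℝ[X]) (C η) (4 * k + 2)
  linear_combination (4 * C c) * e1 - (4 * C c) * e2 - (4 * C c ^ 2) * e3

lemma norm_geom_sum₂_le (z w : ℂ) (s : ℝ) (hz : ‖z‖ ≤ s) (hw : ‖w‖ ≤ s) (n : ℕ) :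
    ‖∑ i ∈ Finset.range n, z ^ i * w ^ (n - 1 - i)‖ ≤ n * s ^ (n - 1) := by
  have hs : 0 ≤ s := (norm_nonneg z).trans hz
  refine (norm_sum_le_of_le (f := fun i => z ^ i * w ^ (n - 1 - i)) _ (n := fun _ => s ^ (n - 1))
    fun i hi => ?_).trans (by simp)
  have hi' : i ≤ n - 1 := by
    have := Finset.mem_range.1 hi
    omega
  rw [norm_mul, norm_pow, norm_pow, ← Nat.add_sub_cancel' hi', pow_add, Nat.add_sub_cancel_left]
  gcongr

lemma one_div_sqrt_sq (k : ℕ) : (1 / √(8 + 8 * (k : ℝ))) ^ 2 = 1 / (8 * (k + 1)) := by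
  rw [div_pow, Real.sq_sqrt (by positivity)]
  ring

lemma one_div_sqrt_le (k : ℕ) : 1 / √(8 + 8 * (k : ℝ)) ≤ 1 / 2 := by
  refine le_of_sq_le_sq ?_ (by norm_num)
  rw [one_div_sqrt_sq, div_pow, one_pow]
  apply one_div_le_one_div_of_le (by norm_num)
  have : (0 : ℝ) ≤ k := by positivity
  linarith

lemma Cc_nonneg (k : ℕ) : 0 ≤ Cc k := by
  unfold Cc
  positivity

lemma Cc_mul_pow_le (k : ℕ) (hk : 2 ≤ k) :
    Cc k * (1 / √(8 + 8 * (k : ℝ))) ^ (2 * k) ≤ 1 / (32 * (k + 1)) := by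
  obtain ⟨n, rfl⟩ : ∃ n, k = n + 1 := ⟨k - 1, by omega⟩
  rw [pow_mul, one_div_sqrt_sq]
  have h1 : Cc (n + 1) ≤ (2 * n) ^ n := by
    unfold Cc
    rw [div_le_iff₀ (by positivity)]
    have h2 := Nat.factorial_mul_ascFactorial n n
    have h3 := Nat.ascFactorial_le_pow_add n n
    rw [show 2 * (n + 1) - 2 = n + n by omega, Nat.add_sub_cancel, ← h2]
    push_cast
    rw [mul_comm]
    gcongr
    rw [two_mul]
    exact_mod_cast h3
  have h4 : (2 * n : ℝ) / (8 * (n + 2)) ≤ 1 / 4 := by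
    rw [div_le_iff₀ (by positivity)]
    linarith
  have h5 : ((1 : ℝ) / 4) ^ n ≤ 1 / 4 := pow_le_of_le_one (by norm_num) (by norm_num) (by omega)
  calc Cc (n + 1) * (1 / (8 * (((n + 1 : ℕ) : ℝ) + 1))) ^ (n + 1)
      ≤ (2 * n) ^ n * (1 / (8 * (((n + 1 : ℕ) : ℝ) + 1))) ^ (n + 1) := by gcongr
    _ = ((2 * n : ℝ) / (8 * (n + 2))) ^ n * (1 / (8 * (n + 2))) := by
        rw [pow_succ, ← mul_assoc, ← mul_pow]
        push_cast
        ring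
    _ ≤ (1 / 4) * (1 / (8 * (n + 2))) := by
        gcongr
        exact (pow_le_pow_left₀ (by positivity) h4 n).trans h5
    _ = _ := by
        push_cast
        field_simp
        ring

lemma re_discQuot_neg (k : ℕ) (hk : 2 ≤ k) (c η : ℝ) (hc0 : 0 ≤ c) (hc : c ≤ Cc k) (hη : 0 < η)
    (hηs : η < 1 / √(8 + 8 * (k : ℝ))) (z : ℂ) (hzs : ‖z‖ ≤ 1 / √(8 + 8 * (k : ℝ)))
    (hz : ‖z‖ ≤ η + 1 / (7 + 8 * k)) : (aeval z (discQuot k c η)).re < 0 := by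
  set s := 1 / √(8 + 8 * (k : ℝ)) with hs
  have hs0 : 0 < s := by positivity
  have hs2 : s ≤ 1 / 2 := one_div_sqrt_le k
  have hcs : c * s ^ (2 * k) ≤ 1 / (32 * (k + 1)) :=
    le_trans (by gcongr) (Cc_mul_pow_le k hk)
  have hw : ‖(η : ℂ)‖ ≤ s := by
    rw [Complex.norm_real, Real.norm_of_nonneg hη.le]
    exact hηs.le
  have e1 := norm_geom_sum₂_le z η s hzs hw (2 * k + 1)
  have e2 := norm_geom_sum₂_le z η s hzs hw (2 * k + 2)
  have e3 := norm_geom_sum₂_le z η s hzs hw (4 * k + 2)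
  set G1 := ∑ i ∈ Finset.range (2 * k + 1), z ^ i * (η : ℂ) ^ (2 * k + 1 - 1 - i)
  set G2 := ∑ i ∈ Finset.range (2 * k + 2), z ^ i * (η : ℂ) ^ (2 * k + 2 - 1 - i)
  set G3 := ∑ i ∈ Finset.range (4 * k + 2), z ^ i * (η : ℂ) ^ (4 * k + 2 - 1 - i)
  have hval : aeval z (discQuot k c η) = -2 - (7 + 8 * (k : ℂ)) * (z + η)
      + ((4 * c : ℝ) : ℂ) * (G1 - G2 - (c : ℂ) * G3) := by
    simp [discQuot, G1, G2, G3, map_ofNat]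
  have hK : (0 : ℝ) < k + 1 := by positivity
  set t := c * s ^ (2 * k) with ht
  have ht0 : 0 ≤ t := by positivity
  have htk : t * (k + 1) ≤ 1 / 32 := by
    have := mul_le_mul_of_nonneg_right hcs hK.le
    refine this.trans_eq ?_
    field_simp
  have ht1 : t ≤ 1 / 32 := by nlinarith [mul_nonneg ht0 (Nat.cast_nonneg (α := ℝ) k)]
  have b1 : c * ‖G1‖ ≤ 1 / 16 := by
    have h1 : c * ‖G1‖ ≤ t * (2 * k + 1) := by
      refine (mul_le_mul_of_nonneg_left e1 hc0).trans_eq ?_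
      rw [ht, Nat.add_sub_cancel]
      push_cast
      ring
    linarith
  have b2 : c * ‖G2‖ ≤ 1 / 32 := by
    have h1 : c * ‖G2‖ ≤ 2 * (t * (k + 1)) * s := by
      refine (mul_le_mul_of_nonneg_left e2 hc0).trans_eq ?_
      rw [ht, show 2 * k + 2 - 1 = 2 * k + 1 by omega]
      push_cast
      ring
    nlinarith
  have b3 : c * (c * ‖G3‖) ≤ 1 / 32 := by
    have h1 : c * (c * ‖G3‖) ≤ t * (t * (4 * k + 2)) * s := by
      refine (mul_le_mul_of_nonneg_left (mul_le_mul_of_nonneg_left e3 hc0) hc0).trans_eq ?_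
      rw [ht, show 4 * k + 2 - 1 = 2 * k + 2 * k + 1 by omega]
      push_cast
      ring
    have h2 : t * (4 * k + 2) ≤ 1 / 8 := by linarith
    have h3 : t * (t * (4 * k + 2)) ≤ (1 / 32) * (1 / 8) :=
      mul_le_mul ht1 h2 (by positivity) (by norm_num)
    nlinarith
  have hE : (((4 * c : ℝ) : ℂ) * (G1 - G2 - (c : ℂ) * G3)).re ≤ 1 / 2 := by
    refine (Complex.re_le_norm _).trans ?_
    rw [norm_mul, Complex.norm_real, Real.norm_of_nonneg (by positivity)]
    have h1 : ‖G1 - G2 - (c : ℂ) * G3‖ ≤ ‖G1‖ + ‖G2‖ + c * ‖G3‖ := by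
      refine (norm_sub_le _ _).trans ?_
      rw [norm_mul, Complex.norm_real, Real.norm_of_nonneg hc0]
      gcongr
      exact norm_sub_le _ _
    have h2 := mul_le_mul_of_nonneg_left h1 hc0
    linarith
  have hre : (-2 - (7 + 8 * (k : ℂ)) * (z + η)).re = -2 - (7 + 8 * (k : ℝ)) * (z.re + η) := by
    simp
  have hzre : -(η + 1 / (7 + 8 * (k : ℝ))) ≤ z.re :=
    (neg_le_neg hz).trans (abs_le.1 (Complex.abs_re_le_norm z)).1
  have h7 : (0 : ℝ) < 7 + 8 * k := by positivity
  have h8 : -1 ≤ (7 + 8 * (k : ℝ)) * (z.re + η) := by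
    have h9 : -(1 / (7 + 8 * (k : ℝ))) ≤ z.re + η := by linarith
    have h10 := mul_le_mul_of_nonneg_left h9 h7.le
    rwa [mul_neg, mul_one_div_cancel h7.ne'] at h10
  rw [hval, Complex.add_re, hre]
  linarith

theorem tendsto_coeff_of_functional_eq (k : ℕ) (hk : 2 ≤ k) (c η : ℝ) (hc0 : 0 ≤ c)
    (hc : c ≤ Cc k) (hη : 0 < η) (hηs : η < 1 / √(8 + 8 * (k : ℝ)))
    (hroot : (disc k c).eval η = 0) (A : PowerSeries ℝ)
    (hA : A = PowerSeries.X * (((k : PowerSeries ℝ) + 1)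
      + (A - PowerSeries.C c * PowerSeries.X ^ (2 * k)) ^ 2 + A ^ 2 + A)) :
    0 < -η * (derivative (disc k c)).eval η ∧
    Tendsto (fun n => 4 * PowerSeries.coeff n A * η ^ (n + 1) / sqrtCoeff (n + 1)) atTop
      (nhds (-√(-η * (derivative (disc k c)).eval η))) := by
  have hD := discQuot_mul k c η hroot
  set Q : ℝ[X] := C (-η) * discQuot k c η with hQdef
  have hQη : Q.eval η = -η * (derivative (disc k c)).eval η := by
    rw [← hD, hQdef]
    simp
  set r := min (1 / √(8 + 8 * (k : ℝ))) (η + 1 / (7 + 8 * k)) with hr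
  have hηr : η < r := lt_min hηs (by
    have : (0 : ℝ) < 1 / (7 + 8 * k) := by positivity
    linarith)
  have hQ : ∀ z : ℂ, ‖z‖ < r → 0 < (aeval z Q).re := fun z hz => by
    have h1 := re_discQuot_neg k hk c η hc0 hc hη hηs z (hz.le.trans (min_le_left _ _))
      (hz.le.trans (min_le_right _ _))
    have h2 : (aeval z Q).re = -η * (aeval z (discQuot k c η)).re := by
      simp [hQdef]
    rw [h2]
    nlinarith
  have hdisc0 : (disc k c).coeff 0 = 1 := by
    rw [coeff_zero_eq_eval_zero]
    simp [disc]
  have hfac : (1 - C η⁻¹ * X) * Q = disc k c := by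
    rw [← hD, hQdef]
    have h1 : (C η⁻¹ : ℝ[X]) * C η = 1 := by
      rw [← C_mul, inv_mul_cancel₀ hη.ne', C_1]
    rw [C_neg]
    linear_combination (X * discQuot k c η) * h1
  have hQ0 : Q.coeff 0 = 1 := by
    have := congrArg (eval 0) hfac
    rw [← coeff_zero_eq_eval_zero, ← coeff_zero_eq_eval_zero, hdisc0, mul_coeff_zero] at this
    simpa using this
  set L : ℝ[X] := 1 - X + 2 * C c * X ^ (2 * k + 1) with hL
  have hL0 : L.coeff 0 = 1 := by
    rw [coeff_zero_eq_eval_zero]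
    simp [hL]
  have hsq : ((L : PowerSeries ℝ) - 4 * PowerSeries.X * A) ^ 2 =
      (1 - PowerSeries.C η⁻¹ * PowerSeries.X) * (Q : PowerSeries ℝ) := by
    have h1 := congrArg (fun p : ℝ[X] => (p : PowerSeries ℝ)) hfac
    have h4 : ∀ m : ℕ, ((m : ℝ[X]) : PowerSeries ℝ) = m := fun m =>
      map_natCast (coeToPowerSeries.ringHom (R := ℝ)) m
    have h5 : ∀ m : ℕ, [m.AtLeastTwo] → (((OfNat.ofNat m : ℝ[X])) : PowerSeries ℝ) = OfNat.ofNat m :=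
      fun m _ => map_ofNat (coeToPowerSeries.ringHom (R := ℝ)) m
    simp only [coe_mul, coe_sub, coe_one, coe_C, coe_X, disc, coe_add, coe_pow, h4, h5] at h1
    rw [h1, hL]
    simp only [coe_mul, coe_sub, coe_one, coe_C, coe_X, coe_add, coe_pow, h5]
    linear_combination (-8 * PowerSeries.X) * hA
  have hlim := tendsto_coeff_of_sq_eq A L Q η r hη hηr hQ hQ0 hL0 hsq
  rw [hQη] at hlim
  refine ⟨?_, hlim⟩
  have h1 := hQ η (by rwa [Complex.norm_real, Real.norm_of_nonneg hη.le])
  rw [← hQη]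
  have h2 := aeval_algebraMap_apply_eq_algebraMap_eval (A := ℂ) η Q
  rw [Complex.coe_algebraMap] at h2
  rwa [h2, Complex.ofReal_re] at h1

end Discriminant

namespace RegEx

variable {A : Type}

/-- Expressions of size `n` satisfying `P`. -/
abbrev OfSize (P : RegEx A → Prop) (n : ℕ) : Type := {e : RegEx A // P e ∧ size e = n}

lemma size_pos (e : RegEx A) : 0 < size e := by
  cases e <;> simp [size]

instance (P : RegEx A → Prop) : IsEmpty (OfSize P 0) :=
  ⟨fun e => (size_pos e.1).ne' e.2.2⟩

/-- Assembling an expression of size `n + 1` from its head symbol and its arguments, where `P'`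
is the constraint on the arguments of a union. -/
def assemble {P P' : RegEx A → Prop} (heps : P eps) (hchar : ∀ a, P (char a))
    (hplus : ∀ l r, P (plus l r) ↔ P' l ∧ P' r) (hcat : ∀ l r, P (cat l r) ↔ P l ∧ P r)
    (hstar : ∀ e, P (star e) ↔ P e) (n : ℕ) :
    (PLift (n = 0) × Option A) ⊕
    (Σ p : Finset.HasAntidiagonal.antidiagonal n, OfSize P' p.1.1 × OfSize P' p.1.2) ⊕
    (Σ p : Finset.HasAntidiagonal.antidiagonal n, OfSize P p.1.1 × OfSize P p.1.2) ⊕ OfSize P n →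
    OfSize P (n + 1)
  | .inl (h, none) => ⟨eps, heps, by simp [size, h.down]⟩
  | .inl (h, some a) => ⟨char a, hchar a, by simp [size, h.down]⟩
  | .inr (.inl ⟨p, l, r⟩) => ⟨plus l.1 r.1, (hplus _ _).2 ⟨l.2.1, r.2.1⟩, by
      rw [size, l.2.2, r.2.2, Finset.HasAntidiagonal.mem_antidiagonal.1 p.2]⟩
  | .inr (.inr (.inl ⟨p, l, r⟩)) => ⟨cat l.1 r.1, (hcat _ _).2 ⟨l.2.1, r.2.1⟩, by
      rw [size, l.2.2, r.2.2, Finset.HasAntidiagonal.mem_antidiagonal.1 p.2]⟩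
  | .inr (.inr (.inr e)) => ⟨star e.1, (hstar _).2 e.2.1, by rw [size, e.2.2]⟩

lemma assemble_bijective {P P' : RegEx A → Prop} (heps : P eps) (hchar : ∀ a, P (char a))
    (hplus : ∀ l r, P (plus l r) ↔ P' l ∧ P' r) (hcat : ∀ l r, P (cat l r) ↔ P l ∧ P r)
    (hstar : ∀ e, P (star e) ↔ P e) (n : ℕ) :
    Function.Bijective (assemble heps hchar hplus hcat hstar n) := by
  constructor
  · rintro (⟨⟨h⟩, _ | a⟩ | ⟨⟨⟨i, j⟩, hp⟩, ⟨l, hl1, hl2⟩, ⟨r, hr1, hr2⟩⟩ |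
      ⟨⟨⟨i, j⟩, hp⟩, ⟨l, hl1, hl2⟩, ⟨r, hr1, hr2⟩⟩ | ⟨e, he⟩)
      (⟨⟨h'⟩, _ | a'⟩ | ⟨⟨⟨i', j'⟩, hp'⟩, ⟨l', hl1', hl2'⟩, ⟨r', hr1', hr2'⟩⟩ |
      ⟨⟨⟨i', j'⟩, hp'⟩, ⟨l', hl1', hl2'⟩, ⟨r', hr1', hr2'⟩⟩ | ⟨e', he'⟩) h0 <;>
    simp only [assemble, Subtype.mk.injEq, reduceCtorEq, plus.injEq, cat.injEq, char.injEq,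
      star.injEq] at h0 <;> try rfl
    · subst h0; rfl
    · obtain ⟨rfl, rfl⟩ := h0
      dsimp only at hl2 hr2 hl2' hr2'
      subst hl2 hr2 hl2' hr2'
      rfl
    · obtain ⟨rfl, rfl⟩ := h0
      dsimp only at hl2 hr2 hl2' hr2'
      subst hl2 hr2 hl2' hr2'
      rfl
    · subst h0; rfl
  · rintro ⟨_ | a | ⟨l, r⟩ | ⟨l, r⟩ | e, hP, hn⟩
    · exact ⟨.inl (⟨by simpa [size] using hn.symm⟩, none), rfl⟩
    · exact ⟨.inl (⟨by simpa [size] using hn.symm⟩, some a), rfl⟩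
    · have h := (hplus _ _).1 hP
      exact ⟨.inr (.inl ⟨⟨(size l, size r), by simpa [size] using hn⟩,
        ⟨l, h.1, rfl⟩, ⟨r, h.2, rfl⟩⟩), rfl⟩
    · have h := (hcat _ _).1 hP
      exact ⟨.inr (.inr (.inl ⟨⟨(size l, size r), by simpa [size] using hn⟩,
        ⟨l, h.1, rfl⟩, ⟨r, h.2, rfl⟩⟩)), rfl⟩
    · exact ⟨.inr (.inr (.inr ⟨e, (hstar _).1 hP, by simpa [size] using hn⟩)), rfl⟩

lemma finite_ofSize_true [Finite A] (n : ℕ) : Finite (OfSize (fun _ : RegEx A => True) n) := by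
  induction n using Nat.strong_induction_on with
  | _ n ih =>
    cases n with
    | zero => infer_instance
    | succ n =>
      have := ih n n.lt_succ_self
      have : ∀ p : Finset.HasAntidiagonal.antidiagonal n,
          Finite (OfSize (fun _ : RegEx A => True) p.1.1 ×
          OfSize (fun _ : RegEx A => True) p.1.2) := fun p => by
        have h := Finset.HasAntidiagonal.mem_antidiagonal.1 p.2
        have := ih p.1.1 (by omega)
        have := ih p.1.2 (by omega)
        infer_instance
      exact Finite.of_surjective _ (assemble_bijective (P := fun _ : RegEx A => True)
        (P' := fun _ => True) trivial (fun _ => trivial) (by simp) (by simp) (by simp) n).2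

instance [Finite A] (P : RegEx A → Prop) (n : ℕ) : Finite (OfSize P n) := by
  have := finite_ofSize_true (A := A) n
  exact Finite.of_injective
    (fun e : OfSize P n => (⟨e.1, trivial, e.2.2⟩ : OfSize (fun _ : RegEx A => True) n))
    fun e e' h => Subtype.ext (Subtype.mk.inj h)

lemma card_ofSize_succ [Fintype A] {P P' : RegEx A → Prop} (heps : P eps) (hchar : ∀ a, P (char a))
    (hplus : ∀ l r, P (plus l r) ↔ P' l ∧ P' r) (hcat : ∀ l r, P (cat l r) ↔ P l ∧ P r)
    (hstar : ∀ e, P (star e) ↔ P e) (n : ℕ) :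
    Nat.card (OfSize P (n + 1)) = (if n = 0 then Fintype.card A + 1 else 0)
      + ∑ p ∈ Finset.HasAntidiagonal.antidiagonal n,
        Nat.card (OfSize P' p.1) * Nat.card (OfSize P' p.2)
      + ∑ p ∈ Finset.HasAntidiagonal.antidiagonal n,
        Nat.card (OfSize P p.1) * Nat.card (OfSize P p.2)
      + Nat.card (OfSize P n) := by
  rw [← Nat.card_congr (Equiv.ofBijective _ (assemble_bijective heps hchar hplus hcat hstar n)),
    Nat.card_sum, Nat.card_sum, Nat.card_sum, Nat.card_sigma, Nat.card_sigma, Nat.card_prod]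
  simp only [Nat.card_prod]
  rw [Finset.sum_coe_sort (Finset.HasAntidiagonal.antidiagonal n)
      (fun p => Nat.card (OfSize P' p.1) * Nat.card (OfSize P' p.2)),
    Finset.sum_coe_sort (Finset.HasAntidiagonal.antidiagonal n)
      (fun p => Nat.card (OfSize P p.1) * Nat.card (OfSize P p.2))]
  have h : Nat.card (PLift (n = 0)) * Nat.card (Option A) =
      if n = 0 then Fintype.card A + 1 else 0 := by
    split_ifs with h
    · have : Unique (PLift (n = 0)) := ⟨⟨⟨h⟩⟩, fun _ => rfl⟩
      simp
    · have : IsEmpty (PLift (n = 0)) := ⟨fun x => h x.down⟩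
      simp
  rw [h]
  ring

/-- The underlying binary tree of unions. -/
def shape : RegEx A → BinaryTree Unit
  | plus l r => .node () (shape l) (shape r)
  | _ => .nil

/-- The letters at the leaves of the tree of unions. -/
def unionLeaves : RegEx A → List A
  | char a => [a]
  | plus l r => unionLeaves l ++ unionLeaves r
  | _ => []

namespace IsUnionOfLetters

lemma unionLeaves_eq {f : RegEx A} {l : List A} (h : IsUnionOfLetters f l) :
    unionLeaves f = l := by
  induction h with
  | char a => rfl
  | plus _ _ h1 h2 => rw [unionLeaves, h1, h2]

lemma numNodes_shape {f : RegEx A} {l : List A} (h : IsUnionOfLetters f l) :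
    (shape f).numNodes + 1 = l.length := by
  induction h with
  | char a => rfl
  | plus _ _ h1 h2 =>
    rw [shape, BinaryTree.numNodes, List.length_append, ← h1, ← h2]
    ring

lemma size_add_one {f : RegEx A} {l : List A} (h : IsUnionOfLetters f l) :
    size f + 1 = 2 * l.length := by
  induction h with
  | char a => rfl
  | plus _ _ h1 h2 =>
    rw [size, List.length_append, mul_add, ← h1, ← h2]
    ring

lemma avoids [Fintype A] {f : RegEx A} {l : List A} (h : IsUnionOfLetters f l) : Avoids f := by
  induction h with
  | char a => trivial
  | plus hl hr h1 h2 =>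
    refine ⟨h1, h2, ?_, ?_⟩
    · rintro ⟨f, l, rfl, -⟩
      cases hl
    · rintro ⟨f, l, rfl, -⟩
      cases hr

lemma eq_of_shape_eq {f f' : RegEx A} {l l' : List A} (h : IsUnionOfLetters f l)
    (h' : IsUnionOfLetters f' l') (hs : shape f = shape f') (hl : l = l') : f = f' := by
  induction h generalizing f' l' with
  | char a =>
    cases h' with
    | char b => simp_all
    | plus => simp [shape] at hs
  | plus h1 h2 ih1 ih2 =>
    cases h' with
    | char b => simp [shape] at hs
    | plus h1' h2' =>
      simp only [shape, BinaryTree.node.injEq, true_and] at hs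
      have hlen := h1.numNodes_shape
      rw [hs.1, h1'.numNodes_shape] at hlen
      obtain ⟨e1, e2⟩ := List.append_inj hl hlen.symm
      rw [ih1 h1' hs.1 e1, ih2 h2' hs.2 e2]

end IsUnionOfLetters

lemma exists_isUnionOfLetters (t : BinaryTree Unit) (l : List A) (h : l.length = t.numNodes + 1) :
    ∃ f, IsUnionOfLetters f l ∧ shape f = t := by
  induction t generalizing l with
  | nil =>
    obtain ⟨a, rfl⟩ := List.length_eq_one_iff.1 h
    exact ⟨char a, .char a, rfl⟩
  | node u t1 t2 ih1 ih2 =>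
    rw [BinaryTree.numNodes] at h
    obtain ⟨f1, h1, s1⟩ := ih1 (l.take (t1.numNodes + 1)) (by rw [List.length_take]; omega)
    obtain ⟨f2, h2, s2⟩ := ih2 (l.drop (t1.numNodes + 1)) (by rw [List.length_drop]; omega)
    refine ⟨plus f1 f2, ?_, by rw [shape, s1, s2]⟩
    have := IsUnionOfLetters.plus h1 h2
    rwa [List.take_append_drop] at this

lemma IsSigmaStar.avoids [Fintype A] {e : RegEx A} (h : IsSigmaStar e) : Avoids e := by
  obtain ⟨f, l, rfl, hf, -⟩ := h
  exact hf.avoids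

lemma nodup_and_forall_mem_iff (k : ℕ) (l : List (Fin k)) :
    (l.Nodup ∧ ∀ a, a ∈ l) ↔ l.Perm (List.finRange k) := by
  constructor
  · rintro ⟨h1, h2⟩
    exact (List.perm_ext_iff_of_nodup h1 (List.nodup_finRange k)).2 fun a => by simp [h2]
  · intro h
    exact ⟨h.nodup_iff.2 (List.nodup_finRange k), fun a => h.mem_iff.2 (List.mem_finRange a)⟩

lemma ncard_union_letters (k : ℕ) (hk : 1 ≤ k) :
    {f : RegEx (Fin k) | ∃ l : List (Fin k), IsUnionOfLetters f l ∧ l.Nodup ∧ ∀ a, a ∈ l}.ncard =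
      catalan (k - 1) * k.factorial := by
  have himg : (fun f : RegEx (Fin k) => (shape f, unionLeaves f)) ''
      {f : RegEx (Fin k) | ∃ l : List (Fin k), IsUnionOfLetters f l ∧ l.Nodup ∧ ∀ a, a ∈ l} =
      ((BinaryTree.treesOfNumNodesEq (k - 1) ×ˢ (List.finRange k).permutations.toFinset :
        Finset (BinaryTree Unit × List (Fin k))) : Set _) := by
    ext ⟨t, l⟩
    simp only [Set.mem_image, Set.mem_ofPred_eq, Prod.mk.injEq, Finset.coe_product, Set.mem_prod,
      Finset.mem_coe, BinaryTree.mem_treesOfNumNodesEq, List.mem_toFinset, List.mem_permutations,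
      nodup_and_forall_mem_iff]
    constructor
    · rintro ⟨f, ⟨l', hf, hl'⟩, rfl, rfl⟩
      have h1 := hf.numNodes_shape
      have h2 := hl'.length_eq
      rw [List.length_finRange] at h2
      rw [hf.unionLeaves_eq]
      exact ⟨by omega, hl'⟩
    · rintro ⟨ht, hl⟩
      have h2 := hl.length_eq
      rw [List.length_finRange] at h2
      obtain ⟨f, hf, hs⟩ := exists_isUnionOfLetters t l (by omega)
      exact ⟨f, ⟨l, hf, hl⟩, hs, hf.unionLeaves_eq⟩
  have hinj : Set.InjOn (fun f : RegEx (Fin k) => (shape f, unionLeaves f))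
      {f : RegEx (Fin k) | ∃ l : List (Fin k), IsUnionOfLetters f l ∧ l.Nodup ∧ ∀ a, a ∈ l} := by
    rintro f ⟨l, hf, -⟩ f' ⟨l', hf', -⟩ h
    simp only [Prod.mk.injEq] at h
    refine hf.eq_of_shape_eq hf' h.1 ?_
    rw [← hf.unionLeaves_eq, ← hf'.unionLeaves_eq, h.2]
  rw [← hinj.ncard_image, himg, Set.ncard_coe_finset, Finset.card_product,
    BinaryTree.treesOfNumNodesEq_card_eq_catalan,
    List.toFinset_card_of_nodup (List.nodup_permutations _ (List.nodup_finRange k)),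
    List.length_permutations, List.length_finRange]

lemma card_isSigmaStar (k n : ℕ) (hk : 1 ≤ k) :
    Nat.card (OfSize (IsSigmaStar (A := Fin k)) n) =
      if n = 2 * k then catalan (k - 1) * k.factorial else 0 := by
  have hsize : ∀ (f : RegEx (Fin k)) (l : List (Fin k)), IsUnionOfLetters f l → l.Nodup →
      (∀ a, a ∈ l) → size (star f) = 2 * k := fun f l hf h1 h2 => by
    have h3 := ((nodup_and_forall_mem_iff k l).1 ⟨h1, h2⟩).length_eq
    rw [List.length_finRange] at h3
    rw [size, hf.size_add_one, h3]
  split_ifs with h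
  · rw [← ncard_union_letters k hk, ← Set.ncard_image_of_injective _
      (fun a b h => (star.injEq a b).mp h : Function.Injective (star (A := Fin k)))]
    change Set.ncard {e : RegEx (Fin k) | IsSigmaStar e ∧ size e = n} = _
    congr 1
    ext e
    constructor
    · rintro ⟨⟨f, l, rfl, hf⟩, -⟩
      exact ⟨f, ⟨l, hf⟩, rfl⟩
    · rintro ⟨f, ⟨l, hf⟩, rfl⟩
      exact ⟨⟨f, l, rfl, hf⟩, (hsize f l hf.1 hf.2.1 hf.2.2).trans h.symm⟩
  · have : IsEmpty (OfSize (IsSigmaStar (A := Fin k)) n) := by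
      refine ⟨?_⟩
      rintro ⟨e, ⟨f, l, rfl, hf⟩, hn⟩
      exact h (hn.symm.trans (hsize f l hf.1 hf.2.1 hf.2.2))
    simp

lemma card_avoids [Fintype A] (n : ℕ) :
    Nat.card (OfSize (Avoids (A := A)) n) =
      Nat.card (OfSize (fun e : RegEx A => Avoids e ∧ ¬ IsSigmaStar e) n) +
        Nat.card (OfSize (IsSigmaStar (A := A)) n) := by
  have h1 : {e : RegEx A | Avoids e ∧ size e = n} =
      {e | (Avoids e ∧ ¬ IsSigmaStar e) ∧ size e = n} ∪ {e | IsSigmaStar e ∧ size e = n} := by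
    ext e
    have := IsSigmaStar.avoids (e := e)
    simp only [Set.mem_ofPred_eq, Set.mem_union]
    tauto
  change Set.ncard {e : RegEx A | Avoids e ∧ size e = n} = Set.ncard _ + Set.ncard _
  rw [h1]
  have hf1 : Finite {e : RegEx A | (Avoids e ∧ ¬ IsSigmaStar e) ∧ size e = n} :=
    inferInstanceAs (Finite (OfSize (fun e : RegEx A => Avoids e ∧ ¬ IsSigmaStar e) n))
  have hf2 : Finite {e : RegEx A | IsSigmaStar e ∧ size e = n} :=
    inferInstanceAs (Finite (OfSize IsSigmaStar n))
  refine Set.ncard_union_eq ?_ (Set.toFinite _) (Set.toFinite _)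
  rw [Set.disjoint_left]
  rintro e ⟨⟨-, h2⟩, -⟩ ⟨h3, -⟩
  exact h2 h3

end RegEx

lemma catalan_mul_factorial (k : ℕ) (hk : 1 ≤ k) :
    ((catalan (k - 1) * k.factorial : ℕ) : ℝ) = Cc k := by
  obtain ⟨n, rfl⟩ : ∃ n, k = n + 1 := ⟨k - 1, by omega⟩
  have h1 := succ_mul_catalan_eq_centralBinom n
  have h2 := Nat.choose_mul_factorial_mul_factorial (n := 2 * n) (k := n) (by omega)
  rw [Cc, eq_div_iff (by positivity), Nat.add_sub_cancel, show 2 * (n + 1) - 2 = 2 * n by omega]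
  rw [← Nat.centralBinom_eq_two_mul_choose, ← h1, show 2 * n - n = n by omega] at h2
  rw [← h2, Nat.factorial_succ]
  push_cast
  ring

lemma Bcount_eq (k n : ℕ) :
    Bcount k n = Nat.card (RegEx.OfSize (fun _ : RegEx (Fin k) => True) n) := by
  simp [Bcount, RegEx.OfSize]

theorem powerSeries_Bcount_eq (k : ℕ) :
    PowerSeries.mk (fun n => (Bcount k n : ℝ)) = PowerSeries.X * (((k : PowerSeries ℝ) + 1)
      + (PowerSeries.mk (fun n => (Bcount k n : ℝ)) - PowerSeries.C 0 * PowerSeries.X ^ (2 * k)) ^ 2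
      + PowerSeries.mk (fun n => (Bcount k n : ℝ)) ^ 2
      + PowerSeries.mk (fun n => (Bcount k n : ℝ))) := by
  have hkC : (k : PowerSeries ℝ) + 1 = PowerSeries.C ((k : ℝ) + 1) := by simp
  rw [map_zero, zero_mul, sub_zero, hkC]
  ext n
  cases n with
  | zero => simp [Bcount_eq]
  | succ n =>
    have h := RegEx.card_ofSize_succ (A := Fin k) (P := fun _ => True) (P' := fun _ => True)
      trivial (fun _ => trivial) (by simp) (by simp) (by simp) n
    simp only [← Bcount_eq, Fintype.card_fin] at h
    rw [PowerSeries.coeff_succ_X_mul, PowerSeries.coeff_mk, h]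
    simp only [map_add, sq, PowerSeries.coeff_mul, PowerSeries.coeff_mk, PowerSeries.coeff_C]
    push_cast
    split_ifs <;> ring

theorem powerSeries_Rcount_eq (k : ℕ) (hk : 1 ≤ k) :
    PowerSeries.mk (fun n => (Rcount k n : ℝ)) = PowerSeries.X * (((k : PowerSeries ℝ) + 1)
      + (PowerSeries.mk (fun n => (Rcount k n : ℝ))
        - PowerSeries.C (Cc k) * PowerSeries.X ^ (2 * k)) ^ 2
      + PowerSeries.mk (fun n => (Rcount k n : ℝ)) ^ 2
      + PowerSeries.mk (fun n => (Rcount k n : ℝ))) := by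
  have hkC : (k : PowerSeries ℝ) + 1 = PowerSeries.C ((k : ℝ) + 1) := by simp
  have hR : ∀ n, Rcount k n = Nat.card (RegEx.OfSize (RegEx.Avoids (A := Fin k)) n) :=
    fun _ => rfl
  have hN : PowerSeries.mk (fun n => (Rcount k n : ℝ))
        - PowerSeries.C (Cc k) * PowerSeries.X ^ (2 * k) = PowerSeries.mk fun n =>
      (Nat.card (RegEx.OfSize
        (fun e : RegEx (Fin k) => RegEx.Avoids e ∧ ¬ RegEx.IsSigmaStar e) n) : ℝ) := by
    ext n
    rw [map_sub, PowerSeries.coeff_C_mul, PowerSeries.coeff_X_pow, PowerSeries.coeff_mk,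
      PowerSeries.coeff_mk, hR, RegEx.card_avoids, RegEx.card_isSigmaStar k n hk]
    split_ifs
    · rw [Nat.cast_add, catalan_mul_factorial k hk]
      ring
    · simp
  rw [hN, hkC]
  ext n
  cases n with
  | zero => simp [hR]
  | succ n =>
    have h := RegEx.card_ofSize_succ (A := Fin k) (P := RegEx.Avoids)
      (P' := fun e => RegEx.Avoids e ∧ ¬ RegEx.IsSigmaStar e)
      trivial (fun _ => trivial) (fun l r => by simp only [RegEx.Avoids]; tauto)
      (fun _ _ => Iff.rfl) (fun _ => Iff.rfl) n
    simp only [← hR, Fintype.card_fin] at h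
    rw [PowerSeries.coeff_succ_X_mul, PowerSeries.coeff_mk, h]
    simp only [map_add, sq, PowerSeries.coeff_mul, PowerSeries.coeff_mk, PowerSeries.coeff_C]
    push_cast
    split_ifs <;> ring

lemma Cc_pos (k : ℕ) : 0 < Cc k := by
  unfold Cc
  positivity

lemma Dd_eq_eval_disc (k : ℕ) : Dd k = fun z => (disc k (Cc k)).eval z := by
  ext z
  simp [Dd, Pp, Hh, disc]

lemma psi_eq (k : ℕ) (x : ℝ) :
    psi k x = -x * (Polynomial.derivative (disc k (Cc k))).eval x := by
  rw [psi, Dd_eq_eval_disc, Polynomial.deriv]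

lemma rho_pos (k : ℕ) : 0 < rho k := by
  unfold rho
  positivity

lemma rho_lt_one_div_sqrt (k : ℕ) : rho k < 1 / √(8 + 8 * (k : ℝ)) := by
  have : 0 < √(8 + 8 * (k : ℝ)) := by positivity
  exact one_div_lt_one_div_of_lt this (by linarith)

lemma rho_quadratic (k : ℕ) : (7 + 8 * (k : ℝ)) * rho k ^ 2 = 1 - 2 * rho k := by
  have h1 : √(8 + 8 * (k : ℝ)) ^ 2 = 8 + 8 * k := Real.sq_sqrt (by positivity)
  have h2 : rho k * √(8 + 8 * (k : ℝ)) = 1 - rho k := by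
    have : rho k * (1 + √(8 + 8 * (k : ℝ))) = 1 := one_div_mul_cancel (by positivity)
    linarith
  linear_combination (rho k * √(8 + 8 * (k : ℝ)) + 1 - rho k) * h2 - rho k ^ 2 * h1

lemma eval_disc_zero_rho (k : ℕ) : (disc k 0).eval (rho k) = 0 := by
  simp only [disc, map_zero, mul_zero, zero_mul, add_zero, Polynomial.eval_sub,
    Polynomial.eval_mul, Polynomial.eval_add, Polynomial.eval_pow, Polynomial.eval_X,
    Polynomial.eval_one, Polynomial.eval_ofNat, Polynomial.eval_natCast]
  linear_combination -rho_quadratic k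

lemma eval_derivative_disc_zero_rho (k : ℕ) :
    -rho k * (Polynomial.derivative (disc k 0)).eval (rho k) = 2 - 2 * rho k := by
  have h : disc k 0 = 1 - 2 * Polynomial.X
      - Polynomial.C (7 + 8 * (k : ℝ)) * Polynomial.X ^ 2 := by
    have h8 : Polynomial.C (7 + 8 * (k : ℝ)) = 7 + 8 * (k : Polynomial ℝ) := by
      simp only [map_add, map_mul, map_ofNat, map_natCast]
    rw [h8]
    simp [disc]
  have h2 : (Polynomial.derivative (disc k 0)).eval (rho k) =
      -2 - (7 + 8 * (k : ℝ)) * (2 * rho k) := by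
    rw [h]
    simp only [Polynomial.derivative_sub, Polynomial.derivative_one, Polynomial.derivative_C,
      Polynomial.derivative_X_sq,
      Polynomial.derivative_mul, Polynomial.derivative_ofNat,
      Polynomial.derivative_X, Polynomial.eval_sub, Polynomial.eval_add, Polynomial.eval_mul,
      Polynomial.eval_C, Polynomial.eval_X, Polynomial.eval_zero, Polynomial.eval_one,
      Polynomial.eval_ofNat]
    ring
  rw [h2]
  linear_combination 2 * rho_quadratic k

lemma rho_lt_of_Dd_eq_zero (k : ℕ) (hk : 2 ≤ k) (η : ℝ) (hη : 0 < η)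
    (hηs : η < 1 / √(8 + 8 * (k : ℝ))) (hroot : Dd k η = 0) : rho k < η := by
  by_contra! h
  have hs := one_div_sqrt_le k
  have hC := Cc_pos k
  have hP : 0 ≤ Pp k η := by
    have h1 : (7 + 8 * (k : ℝ)) * η ^ 2 ≤ (7 + 8 * (k : ℝ)) * rho k ^ 2 := by gcongr
    rw [rho_quadratic] at h1
    unfold Pp
    linarith
  have hH : 0 < Hh k η := by
    have h1 : Cc k * η ^ (2 * k) ≤ 1 / 32 := calc
      Cc k * η ^ (2 * k) ≤ Cc k * (1 / √(8 + 8 * (k : ℝ))) ^ (2 * k) := by gcongr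
      _ ≤ 1 / (32 * (k + 1)) := Cc_mul_pow_le k hk
      _ ≤ 1 / 32 := by
        apply one_div_le_one_div_of_le (by norm_num)
        have : (0 : ℝ) ≤ k := by positivity
        linarith
    have h2 : Cc k * η ^ (2 * k) * η ≤ 1 / 32 * η := by gcongr
    unfold Hh
    rw [pow_succ]
    linarith
  have : 0 < 4 * Cc k * η ^ (2 * k + 1) * Hh k η := by positivity
  unfold Dd at hroot
  linarith

/-- For every integer `k ≥ 2`, with `b_n` the number of all regular
expressions over `Σ` of size `n`, the ratio `R_n/b_n` is asymptotically equivalent, as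
`n → ∞`, to `(√(ψ_k(η_k))/√(2−2ρ_k))·(ρ_k/η_k)^{n+1}`; in particular, since `ρ_k < η_k`,
the ratio `R_n/b_n` tends to `0` as `n → ∞`. -/
theorem statement14 (k : ℕ) (hk : 2 ≤ k) (η : ℝ) (hη : IsEta k η) :
    Asymptotics.IsEquivalent atTop
      (fun n : ℕ => (Rcount k n : ℝ) / (Bcount k n : ℝ))
      (fun n : ℕ => Real.sqrt (psi k η) / Real.sqrt (2 - 2 * rho k)
        * (rho k / η) ^ (n + 1)) ∧
    Tendsto (fun n : ℕ => (Rcount k n : ℝ) / (Bcount k n : ℝ)) atTop (nhds 0) := by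
  obtain ⟨⟨hη0, hηs⟩, hroot, -⟩ := hη
  have hρ0 := rho_pos k
  have hlt := rho_lt_of_Dd_eq_zero k hk η hη0 hηs hroot
  have hroot' : (disc k (Cc k)).eval η = 0 := by rwa [Dd_eq_eval_disc] at hroot
  obtain ⟨hψ, hR⟩ := tendsto_coeff_of_functional_eq k hk (Cc k) η (Cc_nonneg k) le_rfl hη0 hηs
    hroot' _ (powerSeries_Rcount_eq k (by omega))
  obtain ⟨hφ, hB⟩ := tendsto_coeff_of_functional_eq k hk 0 (rho k) le_rfl (Cc_nonneg k) hρ0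
    (rho_lt_one_div_sqrt k) (eval_disc_zero_rho k) _ (powerSeries_Bcount_eq k)
  rw [← psi_eq] at hψ hR
  rw [eval_derivative_disc_zero_rho] at hφ hB
  simp only [PowerSeries.coeff_mk] at hR hB
  have hψ' := Real.sqrt_pos.2 hψ
  have hφ' := Real.sqrt_pos.2 hφ
  have hequiv : Asymptotics.IsEquivalent atTop
      (fun n : ℕ => (Rcount k n : ℝ) / (Bcount k n : ℝ))
      (fun n : ℕ => √(psi k η) / √(2 - 2 * rho k) * (rho k / η) ^ (n + 1)) := by
    apply Asymptotics.isEquivalent_of_tendsto_one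
    have h := (hR.div hB (neg_ne_zero.2 hφ'.ne')).div_const (√(psi k η) / √(2 - 2 * rho k))
    rw [neg_div_neg_eq, div_self (div_pos hψ' hφ').ne'] at h
    refine h.congr fun n => ?_
    have hV := sqrtCoeff_ne_zero (n + 1)
    simp only [Pi.div_apply, div_pow]
    by_cases hn : (Bcount k n : ℝ) = 0
    · simp [hn]
    · field_simp
  refine ⟨hequiv, hequiv.symm.tendsto_nhds ?_⟩
  have h := (tendsto_pow_atTop_nhds_zero_of_lt_one (div_pos hρ0 hη0).le
    ((div_lt_one hη0).2 hlt)).comp (tendsto_add_atTop_nat 1)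
  simpa using h.const_mul (√(psi k η) / √(2 - 2 * rho k))
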